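/- (Elliptic intervals) Let w be an elliptic isometry of E = ℝⁿ with move-set the linear subspace U = Mov(w) ⊆ V. Then every isometry u in the interval [1,w] is elliptic with Mov(u) a linear subspace of U, and the map u ↦ Mov(u) is an order isomorphism from the interval [1,w] (with its betweenness partial order) onto the lattice of all linear subspaces of U ordered by inclusion. In particular, [1,w] is a lattice. -/

import Mathlib

open scoped RealInnerProductSpace

noncomputable section

/-- `n`-dimensional euclidean space `E = ℝⁿ` (also used as the vector space `V` of
translations). -/
abbrev Euc (n : ℕ) := EuclideanSpace ℝ (Fin n)

/-- An isometry of `E`: a surjective distance-preserving map of `E` to itself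
(such a map is automatically an affine bijection). -/
abbrev Iso (n : ℕ) := Euc n ≃ᵢ Euc n

/-- The move-set `Mov(w) = { w(x) - x : x ∈ E } ⊆ V`. -/
def MovSet (n : ℕ) (w : Iso n) : Set (Euc n) := {v | ∃ x, w x - x = v}

/-- The fix-set `Fix(w) = { x ∈ E : w(x) = x }`. -/
def FixSet (n : ℕ) (w : Iso n) : Set (Euc n) := {x | w x = x}

/-- A reflection: a nontrivial isometry fixing pointwise an affine hyperplane,
i.e. a nonempty affine subspace of codimension one. -/
def IsReflection (n : ℕ) (r : Iso n) : Prop :=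
  r ≠ 1 ∧ ∃ H : AffineSubspace ℝ (Euc n), (H : Set (Euc n)).Nonempty ∧
    Module.finrank ℝ H.direction + 1 = n ∧ ∀ x ∈ H, r x = x

/-- The reflection length `ℓ(w)`: the least `k` such that `w` is a product of `k`
reflections. -/
def reflLen (n : ℕ) (w : Iso n) : ℕ :=
  sInf {k | ∃ l : List (Iso n), l.length = k ∧ (∀ r ∈ l, IsReflection n r) ∧ l.prod = w}

/-- `u` lies in the interval `[1, w]`:  `ℓ(u) + ℓ(u⁻¹w) = ℓ(w)`. -/
def inInterval (n : ℕ) (w u : Iso n) : Prop :=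
  reflLen n u + reflLen n (u⁻¹ * w) = reflLen n w

/-- The betweenness partial order on the interval `[1, w]`:
`u ≤ v` iff `ℓ(u) + ℓ(u⁻¹v) + ℓ(v⁻¹w) = ℓ(w)`. -/
def intervalLE (n : ℕ) (w u v : Iso n) : Prop :=
  reflLen n u + reflLen n (u⁻¹ * v) + reflLen n (v⁻¹ * w) = reflLen n w

/-- The set of directions `Dir(S) = { m - m' : m, m' ∈ S }` of a subset `S`. -/
def dirSet (n : ℕ) (S : Set (Euc n)) : Set (Euc n) := {d | ∃ m ∈ S, ∃ m' ∈ S, d = m - m'}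

/-- `α` is a root of the reflection `r`: a nonzero vector orthogonal to the
direction space of the fixed hyperplane of `r`. -/
def IsRoot (n : ℕ) (r : Iso n) (α : Euc n) : Prop :=
  α ≠ 0 ∧ ∀ x y : Euc n, r x = x → r y = y → ⟪α, y - x⟫ = 0

section EllipticIntervals

variable {n : ℕ}

/-- The linear part of an isometry. -/
def linPart (u : Iso n) : Euc n →ₗ[ℝ] Euc n :=
  u.toRealAffineIsometryEquiv.linearIsometryEquiv.toLinearEquiv.toLinearMap

lemma linPart_sub (u : Iso n) (x y : Euc n) : linPart u (x - y) = u x - u y := by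
  have h := u.toRealAffineIsometryEquiv.map_vsub x y
  simpa [linPart] using h

lemma apply_add (u : Iso n) (x a : Euc n) : u (x + a) = u x + linPart u a := by
  have h := linPart_sub u (x + a) x
  rw [add_sub_cancel_left] at h
  rw [h]; abel

lemma inner_linPart (u : Iso n) (x y : Euc n) : ⟪linPart u x, linPart u y⟫ = ⟪x, y⟫ :=
  u.toRealAffineIsometryEquiv.linearIsometryEquiv.inner_map_map x y

lemma linPart_mul (u v : Iso n) (a : Euc n) :
    linPart (u * v) a = linPart u (linPart v a) := by
  have h := linPart_sub (u * v) a 0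
  have h' := linPart_sub v a 0
  rw [sub_zero] at h h'
  rw [h, h', linPart_sub]
  rfl

/-- The move-set of the linear part of an isometry. -/
def linMov (u : Iso n) : Submodule ℝ (Euc n) := LinearMap.range (linPart u - LinearMap.id)

lemma linPart_sub_mem (u : Iso n) (a : Euc n) : linPart u a - a ∈ linMov u := ⟨a, rfl⟩

lemma mem_linMov_orthogonal {u : Iso n} {a : Euc n} :
    a ∈ (linMov u)ᗮ ↔ linPart u a = a := by
  constructor
  · intro h
    have h0 : ⟪linPart u a - a, a⟫ = 0 :=
      (Submodule.mem_orthogonal _ _).1 h _ (linPart_sub_mem u a)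
    have h1 : ⟪linPart u a - a, linPart u a - a⟫ = 0 := by
      have h2 := inner_linPart u a a
      have h3 := real_inner_comm (linPart u a) a
      simp only [inner_sub_left, inner_sub_right] at h0 ⊢
      linarith
    exact sub_eq_zero.1 (inner_self_eq_zero.1 h1)
  · intro h
    rw [Submodule.mem_orthogonal]
    rintro _ ⟨y, rfl⟩
    have h2 := inner_linPart u y a
    rw [h] at h2
    simp [inner_sub_left, h2]

lemma movSet_eq_linMov {u : Iso n} (hu : (FixSet n u).Nonempty) :
    MovSet n u = (linMov u : Set (Euc n)) := by
  obtain ⟨p, hp : u p = p⟩ := hu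
  ext v
  constructor
  · rintro ⟨x, rfl⟩
    refine ⟨x - p, ?_⟩
    simp [linPart_sub, hp]
  · rintro ⟨a, rfl⟩
    refine ⟨p + a, ?_⟩
    simp [apply_add, hp]

lemma zero_mem_movSet {u : Iso n} : (0 : Euc n) ∈ MovSet n u ↔ (FixSet n u).Nonempty := by
  simp [MovSet, FixSet, Set.Nonempty, sub_eq_zero]

lemma linMov_mul_le (u v : Iso n) : linMov (u * v) ≤ linMov u ⊔ linMov v := by
  rintro _ ⟨a, rfl⟩
  refine Submodule.mem_sup.2 ⟨_, linPart_sub_mem u (linPart v a), _, linPart_sub_mem v a, ?_⟩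
  simp [linPart_mul]

lemma linMov_orthogonal_sup_eq_top {u v : Iso n} (h : linMov u ⊓ linMov v = ⊥) :
    (linMov u)ᗮ ⊔ (linMov v)ᗮ = ⊤ := by
  rw [← Submodule.orthogonal_eq_bot_iff, ← Submodule.inf_orthogonal]
  simpa using h

lemma fixSet_mul_nonempty {u v : Iso n} (hu : (FixSet n u).Nonempty)
    (hv : (FixSet n v).Nonempty) (h : linMov u ⊓ linMov v = ⊥) :
    (FixSet n (u * v)).Nonempty := by
  obtain ⟨p, hp : u p = p⟩ := hu
  obtain ⟨q, hq : v q = q⟩ := hv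
  have hpq : q - p ∈ (linMov u)ᗮ ⊔ (linMov v)ᗮ := by
    rw [linMov_orthogonal_sup_eq_top h]; trivial
  obtain ⟨a, ha, b, hb, hab⟩ := Submodule.mem_sup.1 hpq
  rw [mem_linMov_orthogonal] at ha hb
  have hx : p + a = q + -b := by
    have : q = a + b + p := by rw [hab]; abel
    rw [this]; abel
  refine ⟨p + a, ?_⟩
  change u (v (p + a)) = p + a
  have hv' : v (p + a) = p + a := by rw [hx, apply_add, hq, map_neg, hb]
  rw [hv', apply_add, hp, ha]

lemma IsReflection.finrank_linMov_le {r : Iso n} (hr : IsReflection n r) :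
    Module.finrank ℝ (linMov r) ≤ 1 := by
  obtain ⟨-, H, ⟨p, hp⟩, hdim, hfix⟩ := hr
  have hle : H.direction ≤ (linMov r)ᗮ := by
    intro a ha
    rw [mem_linMov_orthogonal]
    have h := hfix _ (AffineSubspace.vadd_mem_of_mem_direction ha hp)
    rw [vadd_eq_add, add_comm, apply_add, hfix p hp] at h
    exact add_left_cancel h
  have h1 := Submodule.finrank_mono hle
  have h2 := (linMov r).finrank_add_finrank_orthogonal
  rw [finrank_euclideanSpace_fin] at h2
  omega

lemma IsReflection.fixSet_nonempty {r : Iso n} (hr : IsReflection n r) :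
    (FixSet n r).Nonempty := by
  obtain ⟨-, H, ⟨p, hp⟩, -, hfix⟩ := hr
  exact ⟨p, hfix p hp⟩

lemma finrank_linMov_prod_le (l : List (Iso n)) (hl : ∀ r ∈ l, IsReflection n r) :
    Module.finrank ℝ (linMov l.prod) ≤ l.length ∧
      (Module.finrank ℝ (linMov l.prod) = l.length → (FixSet n l.prod).Nonempty) := by
  induction l with
  | nil =>
    have h : linMov (1 : Iso n) = ⊥ := by
      rw [← Submodule.orthogonal_eq_top_iff, eq_top_iff]
      intro a _
      rw [mem_linMov_orthogonal]
      have h := linPart_sub (1 : Iso n) a 0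
      rw [sub_zero] at h
      simpa using h
    exact ⟨by rw [List.prod_nil, h, finrank_bot]; exact Nat.zero_le _, fun _ => ⟨0, rfl⟩⟩
  | cons r l ih =>
    have hr := hl r (by simp)
    obtain ⟨ih1, ih2⟩ := ih fun s hs => hl s (by simp [hs])
    have h1 := hr.finrank_linMov_le
    have h2 := Submodule.finrank_mono (linMov_mul_le r l.prod)
    have h3 := Submodule.finrank_sup_add_finrank_inf_eq (linMov r) (linMov l.prod)
    rw [List.prod_cons, List.length_cons]
    refine ⟨by omega, fun h => fixSet_mul_nonempty hr.fixSet_nonempty (ih2 (by omega)) ?_⟩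
    exact Submodule.finrank_eq_zero.1 (by omega)

/-- Two distinct points are swapped by the reflection in their perpendicular bisector. -/
lemma exists_reflection_swap {p q : Euc n} (hpq : p ≠ q) :
    ∃ r : Iso n, IsReflection n r ∧ r p = q ∧ r * r = 1 ∧
      ∀ x, dist x p = dist x q → r x = x := by
  have hne : Nonempty (AffineSubspace.perpBisector p q) :=
    AffineSubspace.perpBisector_nonempty.to_subtype
  let r : Iso n := (EuclideanGeometry.reflection (AffineSubspace.perpBisector p q)).toIsometryEquiv
  have hfix : ∀ x, dist x p = dist x q → r x = x := fun x hx =>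
    (EuclideanGeometry.reflection_eq_self_iff x).2 (AffineSubspace.mem_perpBisector_iff_dist_eq.2 hx)
  have hswap : r p = q := by
    have hv : (2⁻¹ : ℝ) • (p - q) ∈ (AffineSubspace.perpBisector p q).directionᗮ := by
      rw [AffineSubspace.direction_perpBisector, Submodule.orthogonal_orthogonal]
      refine Submodule.mem_span_singleton.2 ⟨-2⁻¹, ?_⟩
      rw [vsub_eq_sub]
      module
    have h := EuclideanGeometry.reflection_orthogonal_vadd
      (AffineSubspace.midpoint_mem_perpBisector p q) hv
    have hp : (2⁻¹ : ℝ) • (p - q) +ᵥ midpoint ℝ p q = p := by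
      rw [vadd_eq_add, midpoint_eq_smul_add, invOf_eq_inv]
      module
    have hq : -((2⁻¹ : ℝ) • (p - q)) +ᵥ midpoint ℝ p q = q := by
      rw [vadd_eq_add, midpoint_eq_smul_add, invOf_eq_inv]
      module
    rwa [hp, hq] at h
  refine ⟨r, ⟨?_, AffineSubspace.perpBisector p q, AffineSubspace.perpBisector_nonempty, ?_, ?_⟩,
    hswap, ?_, hfix⟩
  · intro h
    rw [h] at hswap
    exact hpq hswap
  · rw [AffineSubspace.direction_perpBisector]
    have h := (ℝ ∙ (q -ᵥ p)).finrank_add_finrank_orthogonal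
    rw [finrank_euclideanSpace_fin, finrank_span_singleton (vsub_ne_zero.2 hpq.symm)] at h
    omega
  · intro x hx
    exact hfix x (AffineSubspace.mem_perpBisector_iff_dist_eq.1 hx)
  · ext1 x
    exact EuclideanGeometry.reflection_reflection (AffineSubspace.perpBisector p q) x

/-- For `γ` a nonzero element of the move-set of an elliptic isometry `w`, there is a reflection
`r` such that `w * r` is elliptic with move-set the part of `linMov w` orthogonal to `γ`. -/
lemma exists_reflection_linMov_mul {w : Iso n} (hw : (FixSet n w).Nonempty) {γ : Euc n}
    (hγ : γ ∈ linMov w) (hγ0 : γ ≠ 0) :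
    ∃ r : Iso n, IsReflection n r ∧ r * r = 1 ∧ (FixSet n (w * r)).Nonempty ∧
      linMov (w * r) = linMov w ⊓ (ℝ ∙ γ)ᗮ ∧
      Module.finrank ℝ (linMov (w * r)) + 1 = Module.finrank ℝ (linMov w) := by
  obtain ⟨x₀, hx₀ : w x₀ = x₀⟩ := hw
  have hne : linPart w γ ≠ γ := by
    intro h
    have h' := (Submodule.mem_orthogonal _ _).1 (mem_linMov_orthogonal.2 h) γ hγ
    exact hγ0 (inner_self_eq_zero.1 h')
  have hpq : x₀ + γ ≠ w.symm (x₀ + γ) := by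
    intro h
    have h' : w (x₀ + γ) = x₀ + γ := by conv_lhs => rw [h, w.apply_symm_apply]
    rw [apply_add, hx₀] at h'
    exact hne (add_left_cancel h')
  obtain ⟨r, hr, hrp, hrr, hrf⟩ := exists_reflection_swap hpq
  have hfix : ∀ x, w x = x → (w * r) x = x := by
    intro x hx
    have hxr : r x = x := by
      apply hrf
      rw [← w.dist_eq x (w.symm _), hx, w.apply_symm_apply]
    change w (r x) = x
    rw [hxr, hx]
  have hfixγ : (w * r) (x₀ + γ) = x₀ + γ := by
    change w (r (x₀ + γ)) = _
    rw [hrp, w.apply_symm_apply]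
  have horth : (linMov w)ᗮ ≤ (linMov (w * r))ᗮ := by
    intro a ha
    rw [mem_linMov_orthogonal] at ha ⊢
    have h := hfix (x₀ + a) (by rw [apply_add, hx₀, ha])
    rw [apply_add, hfix x₀ hx₀] at h
    exact add_left_cancel h
  have hγorth : γ ∈ (linMov (w * r))ᗮ := by
    rw [mem_linMov_orthogonal]
    rw [apply_add, hfix x₀ hx₀] at hfixγ
    exact add_left_cancel hfixγ
  have hle1 : linMov (w * r) ≤ linMov w := Submodule.orthogonal_le_orthogonal_iff.1 horth
  have hle2 : linMov (w * r) ≤ (ℝ ∙ γ)ᗮ := by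
    rw [Submodule.le_orthogonal_iff_le_orthogonal, Submodule.span_singleton_le_iff_mem]
    exact hγorth
  have hle : linMov (w * r) ≤ linMov w ⊓ (ℝ ∙ γ)ᗮ := le_inf hle1 hle2
  have hlt : linMov w ⊓ (ℝ ∙ γ)ᗮ < linMov w := by
    refine lt_of_le_of_ne inf_le_left fun h => ?_
    have h' : γ ∈ (ℝ ∙ γ)ᗮ := (inf_eq_left.1 h) hγ
    exact hγ0 (inner_self_eq_zero.1 (Submodule.mem_orthogonal_singleton_iff_inner_right.1 h'))
  have hd1 := Submodule.finrank_lt_finrank_of_lt hlt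
  have hd2 := Submodule.finrank_mono hle
  have hd3 := Submodule.finrank_mono (linMov_mul_le (w * r) r)
  rw [mul_assoc, hrr, mul_one] at hd3
  have hd4 := Submodule.finrank_sup_add_finrank_inf_eq (linMov (w * r)) (linMov r)
  have hd5 := hr.finrank_linMov_le
  exact ⟨r, hr, hrr, ⟨x₀, hfix x₀ hx₀⟩, Submodule.eq_of_le_of_finrank_le hle (by omega), by omega⟩

lemma linMov_eq_bot {w : Iso n} (hw : (FixSet n w).Nonempty) (h : linMov w = ⊥) : w = 1 := by
  obtain ⟨p, hp : w p = p⟩ := hw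
  ext1 x
  have hx : linPart w (x - p) = x - p := by
    rw [← mem_linMov_orthogonal, h, Submodule.bot_orthogonal_eq_top]; trivial
  have h' := apply_add w p (x - p)
  rw [hx, hp, add_sub_cancel] at h'
  exact h'

/-- An elliptic isometry is a product of as many reflections as the dimension of its move-set. -/
lemma exists_list_of_elliptic (k : ℕ) : ∀ w : Iso n, (FixSet n w).Nonempty →
    Module.finrank ℝ (linMov w) = k →
    ∃ l : List (Iso n), l.length = k ∧ (∀ r ∈ l, IsReflection n r) ∧ l.prod = w := by
  induction k with
  | zero =>
    intro w hw hk
    exact ⟨[], rfl, by simp, (linMov_eq_bot hw (Submodule.finrank_eq_zero.1 hk)).symm⟩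
  | succ k ih =>
    intro w hw hk
    obtain ⟨γ, hγ, hγ0⟩ := (linMov w).exists_mem_ne_zero_of_ne_bot (by
      intro h
      rw [h, finrank_bot] at hk
      omega)
    obtain ⟨r, hr, hrr, hfix, -, hd⟩ := exists_reflection_linMov_mul hw hγ hγ0
    obtain ⟨l, hl, hlr, hlp⟩ := ih (w * r) hfix (by omega)
    refine ⟨l ++ [r], by simp [hl], ?_, by simp [hlp, mul_assoc, hrr]⟩
    intro s hs
    rcases List.mem_append.1 hs with hs | hs
    · exact hlr s hs
    · rw [List.mem_singleton.1 hs]; exact hr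

lemma exists_list (w : Iso n) :
    ∃ l : List (Iso n), (∀ r ∈ l, IsReflection n r) ∧ l.prod = w := by
  by_cases h : w 0 = 0
  · obtain ⟨l, -, hl⟩ := exists_list_of_elliptic _ w ⟨0, h⟩ rfl
    exact ⟨l, hl⟩
  · obtain ⟨r, hr, hrp, hrr, -⟩ := exists_reflection_swap h
    obtain ⟨l, -, hl, hlp⟩ := exists_list_of_elliptic _ (r * w) ⟨0, hrp⟩ rfl
    refine ⟨r :: l, ?_, by rw [List.prod_cons, hlp, ← mul_assoc, hrr, one_mul]⟩
    intro s hs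
    rcases List.mem_cons.1 hs with hs | hs
    · rw [hs]; exact hr
    · exact hl s hs

lemma reflLen_prod_le (l : List (Iso n)) (hl : ∀ r ∈ l, IsReflection n r) :
    reflLen n l.prod ≤ l.length :=
  Nat.sInf_le ⟨l, rfl, hl, rfl⟩

lemma exists_list_length_eq_reflLen (w : Iso n) :
    ∃ l : List (Iso n), l.length = reflLen n w ∧ (∀ r ∈ l, IsReflection n r) ∧ l.prod = w := by
  obtain ⟨l, hl, hlp⟩ := exists_list w
  exact Nat.sInf_mem (s := {k | ∃ l : List (Iso n), l.length = k ∧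
    (∀ r ∈ l, IsReflection n r) ∧ l.prod = w}) ⟨_, l, rfl, hl, hlp⟩

lemma finrank_linMov_le_reflLen (w : Iso n) : Module.finrank ℝ (linMov w) ≤ reflLen n w := by
  obtain ⟨l, hl, hlr, rfl⟩ := exists_list_length_eq_reflLen w
  exact hl ▸ (finrank_linMov_prod_le l hlr).1

/-- Reflection length equals the dimension of the linear move-set exactly for elliptic
isometries. -/
lemma reflLen_eq_finrank_iff {w : Iso n} :
    reflLen n w = Module.finrank ℝ (linMov w) ↔ (FixSet n w).Nonempty := by
  constructor
  · intro h
    obtain ⟨l, hl, hlr, rfl⟩ := exists_list_length_eq_reflLen w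
    exact (finrank_linMov_prod_le l hlr).2 (by omega)
  · intro h
    obtain ⟨l, hl, hlr, rfl⟩ := exists_list_of_elliptic _ w h rfl
    exact le_antisymm (hl ▸ reflLen_prod_le l hlr) (finrank_linMov_le_reflLen _)

lemma reflLen_mul_le (u v : Iso n) : reflLen n (u * v) ≤ reflLen n u + reflLen n v := by
  obtain ⟨l, hl, hlr, rfl⟩ := exists_list_length_eq_reflLen u
  obtain ⟨m, hm, hmr, rfl⟩ := exists_list_length_eq_reflLen v
  rw [← hl, ← hm, ← List.prod_append, ← List.length_append]
  refine reflLen_prod_le _ fun s hs => ?_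
  rcases List.mem_append.1 hs with hs | hs
  · exact hlr s hs
  · exact hmr s hs

lemma IsReflection.reflLen_le_one {r : Iso n} (hr : IsReflection n r) : reflLen n r ≤ 1 := by
  simpa using reflLen_prod_le [r] (by simpa using hr)

lemma inInterval.of_le {w u : Iso n} (h : reflLen n u + reflLen n (u⁻¹ * w) ≤ reflLen n w) :
    inInterval n w u := by
  have h' := reflLen_mul_le u (u⁻¹ * w)
  rw [mul_inv_cancel_left] at h'
  exact le_antisymm h h'

/-- An element `u` of the interval below an elliptic `w` is elliptic, as is `u⁻¹ * w`; their linear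
move-sets are independent, and that of `u` is contained in that of `w`. -/
lemma inInterval.fixSet_nonempty_and_linMov_le {w u : Iso n} (hw : (FixSet n w).Nonempty)
    (hu : inInterval n w u) :
    (FixSet n u).Nonempty ∧ (FixSet n (u⁻¹ * w)).Nonempty ∧ linMov u ≤ linMov w ∧
      linMov u ⊓ linMov (u⁻¹ * w) = ⊥ := by
  have hle := linMov_mul_le u (u⁻¹ * w)
  rw [mul_inv_cancel_left] at hle
  have h1 := Submodule.finrank_mono hle
  have h2 := Submodule.finrank_sup_add_finrank_inf_eq (linMov u) (linMov (u⁻¹ * w))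
  have h3 := finrank_linMov_le_reflLen u
  have h4 := finrank_linMov_le_reflLen (u⁻¹ * w)
  have h5 := reflLen_eq_finrank_iff.2 hw
  unfold inInterval at hu
  refine ⟨reflLen_eq_finrank_iff.1 (by omega), reflLen_eq_finrank_iff.1 (by omega), ?_,
    Submodule.finrank_eq_zero.1 (by omega)⟩
  rw [Submodule.eq_of_le_of_finrank_le hle (by omega)]
  exact le_sup_left

lemma inInterval.apply_eq {w u : Iso n} (hw : (FixSet n w).Nonempty) (hu : inInterval n w u)
    {x : Euc n} (hx : w x = x) : u x = x := by
  obtain ⟨h1, h2, -, h4⟩ := hu.fixSet_nonempty_and_linMov_le hw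
  have hux : u ((u⁻¹ * w) x) = x := by
    change (u * (u⁻¹ * w)) x = x
    rw [mul_inv_cancel_left, hx]
  have hm1 : (u⁻¹ * w) x - x ∈ linMov (u⁻¹ * w) := by
    rw [← SetLike.mem_coe, ← movSet_eq_linMov h2]
    exact ⟨x, rfl⟩
  have hm2 : (u⁻¹ * w) x - x ∈ linMov u := by
    rw [← neg_mem_iff, ← SetLike.mem_coe, ← movSet_eq_linMov h1]
    exact ⟨(u⁻¹ * w) x, by rw [hux, neg_sub]⟩
  have h0 : (u⁻¹ * w) x - x ∈ linMov u ⊓ linMov (u⁻¹ * w) := ⟨hm2, hm1⟩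
  rw [h4, Submodule.mem_bot, sub_eq_zero] at h0
  rwa [h0] at hux

lemma inInterval.linPart_eq {w u : Iso n} (hw : (FixSet n w).Nonempty) (hu : inInterval n w u)
    {a : Euc n} (ha : linPart w a - a ∈ linMov u) : linPart u a = linPart w a := by
  obtain ⟨-, -, -, h4⟩ := hu.fixSet_nonempty_and_linMov_le hw
  have hw' : linPart w a = linPart u (linPart (u⁻¹ * w) a) := by
    rw [← linPart_mul, mul_inv_cancel_left]
  have hm : linPart (u⁻¹ * w) a - a ∈ linMov u := by
    have h := sub_mem ha (linPart_sub_mem u (linPart (u⁻¹ * w) a))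
    rw [hw'] at h
    simpa using h
  have h0 : linPart (u⁻¹ * w) a - a ∈ linMov u ⊓ linMov (u⁻¹ * w) := ⟨hm, linPart_sub_mem _ a⟩
  rw [h4, Submodule.mem_bot, sub_eq_zero] at h0
  rw [hw', h0]

lemma inInterval.eq_of_linMov_eq {w u u' : Iso n} (hw : (FixSet n w).Nonempty)
    (hu : inInterval n w u) (hu' : inInterval n w u') (h : linMov u' = linMov u) : u' = u := by
  obtain ⟨p, hp : w p = p⟩ := id hw
  obtain ⟨-, -, -, h4⟩ := hu.fixSet_nonempty_and_linMov_le hw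
  ext1 x
  have hx : x - p ∈ (linMov u)ᗮ ⊔ (linMov (u⁻¹ * w))ᗮ := by
    rw [linMov_orthogonal_sup_eq_top h4]; trivial
  obtain ⟨b, hb, a, ha, hab⟩ := Submodule.mem_sup.1 hx
  have hb' : linPart u' b = b := by rwa [← mem_linMov_orthogonal, h]
  rw [mem_linMov_orthogonal] at ha hb
  have hwa : linPart w a = linPart u a := by
    conv_rhs => rw [← ha, ← linPart_mul, mul_inv_cancel_left]
  have ha' : linPart u' a = linPart w a := by
    apply hu'.linPart_eq hw
    rw [hwa, h]
    exact linPart_sub_mem u a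
  have hxp : x = p + (b + a) := by rw [hab]; abel
  rw [hxp, apply_add, apply_add, hu.apply_eq hw hp, hu'.apply_eq hw hp, map_add, map_add, hb, hb',
    ha', hwa]

lemma exists_inInterval_linMov_eq (S : Submodule ℝ (Euc n)) (k : ℕ) : ∀ w : Iso n,
    (FixSet n w).Nonempty → Module.finrank ℝ (linMov w) = k → S ≤ linMov w →
    ∃ u, inInterval n w u ∧ linMov u = S := by
  have hself : ∀ w : Iso n, inInterval n w w := by
    intro w
    have h := reflLen_prod_le ([] : List (Iso n)) (by simp)
    apply inInterval.of_le
    simpa using h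
  induction k with
  | zero =>
    intro w _ hk hS
    have hbot := Submodule.finrank_eq_zero.1 hk
    exact ⟨w, hself w, by rw [hbot, eq_comm, ← le_bot_iff, ← hbot]; exact hS⟩
  | succ k ih =>
    intro w hw hk hS
    by_cases heq : linMov w = S
    · exact ⟨w, hself w, heq⟩
    · obtain ⟨γ, hγ, hγ0⟩ := (Sᗮ ⊓ linMov w).exists_mem_ne_zero_of_ne_bot fun h => by
        have := Submodule.sup_orthogonal_inf_of_hasOrthogonalProjection hS
        rw [h, sup_bot_eq] at this
        exact heq this.symm
      obtain ⟨r, hr, hrr, hfix, hmov, hd⟩ := exists_reflection_linMov_mul hw hγ.2 hγ0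
      obtain ⟨u, hu, huS⟩ := ih (w * r) hfix (by omega) (by
        rw [hmov]
        refine le_inf hS ?_
        rw [Submodule.le_orthogonal_iff_le_orthogonal, Submodule.span_singleton_le_iff_mem]
        exact hγ.1)
      refine ⟨u, inInterval.of_le ?_, huS⟩
      have h1 := reflLen_mul_le (u⁻¹ * (w * r)) r
      rw [mul_assoc, mul_assoc, hrr, mul_one] at h1
      have h2 := hr.reflLen_le_one
      have h3 := reflLen_eq_finrank_iff.2 hw
      have h4 := reflLen_eq_finrank_iff.2 hfix
      unfold inInterval at hu
      omega

lemma intervalLE_iff_inInterval {w u v : Iso n} (hv : inInterval n w v) :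
    intervalLE n w u v ↔ inInterval n v u := by
  unfold intervalLE inInterval at *
  omega

lemma inInterval.trans {w u v : Iso n} (hv : inInterval n w v) (hu : inInterval n v u) :
    inInterval n w u := by
  apply inInterval.of_le
  have h := reflLen_mul_le (u⁻¹ * v) (v⁻¹ * w)
  rw [mul_assoc, mul_inv_cancel_left] at h
  unfold inInterval at hu hv
  omega

lemma intervalLE_iff_linMov_le {w u v : Iso n} (hw : (FixSet n w).Nonempty)
    (hu : inInterval n w u) (hv : inInterval n w v) :
    intervalLE n w u v ↔ linMov u ≤ linMov v := by
  have hfv := (hv.fixSet_nonempty_and_linMov_le hw).1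
  rw [intervalLE_iff_inInterval hv]
  refine ⟨fun h => (h.fixSet_nonempty_and_linMov_le hfv).2.2.1, fun h => ?_⟩
  obtain ⟨u', hu', hmov⟩ := exists_inInterval_linMov_eq _ _ v hfv rfl h
  rwa [← (hu.eq_of_linMov_eq hw (hv.trans hu') hmov)]

end EllipticIntervals

/-- Elliptic intervals: for `w` elliptic with move-set the linear
subspace `U`, every `u ∈ [1,w]` is elliptic with `Mov(u)` a linear subspace of `U`,
and `u ↦ Mov(u)` is an order isomorphism from `[1,w]` onto the lattice of linear
subspaces of `U`; in particular `[1,w]` is a lattice. -/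
theorem elliptic_interval_iso (n : ℕ) (w : Iso n) (U : Submodule ℝ (Euc n))
    (hell : (0 : Euc n) ∈ MovSet n w)
    (hU : (U : Set (Euc n)) = MovSet n w) :
    (∀ u, inInterval n w u → (0 : Euc n) ∈ MovSet n u ∧
        ∃ S : Submodule ℝ (Euc n), (S : Set (Euc n)) = MovSet n u ∧ S ≤ U) ∧
    (∀ S : Submodule ℝ (Euc n), S ≤ U →
        ∃ u, inInterval n w u ∧ MovSet n u = (S : Set (Euc n)) ∧
          ∀ u', inInterval n w u' → MovSet n u' = (S : Set (Euc n)) → u' = u) ∧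
    (∀ u v, inInterval n w u → inInterval n w v →
        (intervalLE n w u v ↔ MovSet n u ⊆ MovSet n v)) ∧
    (∀ u v, inInterval n w u → inInterval n w v →
        (∃ j, inInterval n w j ∧ intervalLE n w u j ∧ intervalLE n w v j ∧
            ∀ j', inInterval n w j' → intervalLE n w u j' → intervalLE n w v j' →
              intervalLE n w j j') ∧
        (∃ m, inInterval n w m ∧ intervalLE n w m u ∧ intervalLE n w m v ∧
            ∀ m', inInterval n w m' → intervalLE n w m' u → intervalLE n w m' v →
              intervalLE n w m' m)) := by
  rw [zero_mem_movSet] at hell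
  have hw := hell
  rw [movSet_eq_linMov hw] at hU
  obtain rfl : U = linMov w := SetLike.coe_injective hU
  have hmov : ∀ u, inInterval n w u → MovSet n u = (linMov u : Set (Euc n)) := fun u hu =>
    movSet_eq_linMov (hu.fixSet_nonempty_and_linMov_le hw).1
  have hle : ∀ u, inInterval n w u → linMov u ≤ linMov w := fun u hu =>
    (hu.fixSet_nonempty_and_linMov_le hw).2.2.1
  refine ⟨fun u hu => ⟨zero_mem_movSet.2 (hu.fixSet_nonempty_and_linMov_le hw).1, linMov u, (hmov u hu).symm,
    hle u hu⟩, fun S hS => ?_, fun u v hu hv => ?_, fun u v hu hv => ⟨?_, ?_⟩⟩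
  · obtain ⟨u, hu, rfl⟩ := exists_inInterval_linMov_eq S _ w hw rfl hS
    refine ⟨u, hu, hmov u hu, fun u' hu' h => hu.eq_of_linMov_eq hw hu' ?_⟩
    rw [hmov u' hu'] at h
    exact SetLike.coe_injective h
  · rw [intervalLE_iff_linMov_le hw hu hv, hmov u hu, hmov v hv, SetLike.coe_subset_coe]
  · obtain ⟨j, hj, hjm⟩ := exists_inInterval_linMov_eq (linMov u ⊔ linMov v) _ w hw rfl
      (sup_le (hle u hu) (hle v hv))
    refine ⟨j, hj, ?_, ?_, fun j' hj' h1 h2 => ?_⟩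
    · rw [intervalLE_iff_linMov_le hw hu hj, hjm]
      exact le_sup_left
    · rw [intervalLE_iff_linMov_le hw hv hj, hjm]
      exact le_sup_right
    · rw [intervalLE_iff_linMov_le hw hj hj', hjm]
      exact sup_le ((intervalLE_iff_linMov_le hw hu hj').1 h1)
        ((intervalLE_iff_linMov_le hw hv hj').1 h2)
  · obtain ⟨m, hm, hmm⟩ := exists_inInterval_linMov_eq (linMov u ⊓ linMov v) _ w hw rfl
      (inf_le_left.trans (hle u hu))
    refine ⟨m, hm, ?_, ?_, fun m' hm' h1 h2 => ?_⟩
    · rw [intervalLE_iff_linMov_le hw hm hu, hmm]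
      exact inf_le_left
    · rw [intervalLE_iff_linMov_le hw hm hv, hmm]
      exact inf_le_right
    · rw [intervalLE_iff_linMov_le hw hm' hm, hmm]
      exact le_inf ((intervalLE_iff_linMov_le hw hm' hu).1 h1)
        ((intervalLE_iff_linMov_le hw hm' hv).1 h2)
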